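/- arXiv:2502.10354 — 2 statements merged into one kernel-verified Lean document; each statement's English description precedes it below -/
import Mathlib

section
/- There exist universal constants c₀ > 0 (small enough) and C > 0 such that the following holds. Let Y be a real random variable that is (β², K)-subGaussian with K ≥ 1, with E[Y] = 0 and E[Y²] ≤ ν², where 0 < ν ≤ βK. Set A := β·√(4·log(βK/ν)) + β·√(2K), and let λ > 0 satisfy λ ≤ c₀/A. Then E[exp(λ²·Y²)] ≤ 1 + C·λ²·ν². -/
open MeasureTheory

/-- The exponential moment of a subGaussian square at half the critical rate. -/
lemma lintegral_exp_sq_le {Ω : Type} [MeasurableSpace Ω] (P : Measure Ω) [IsProbabilityMeasure P]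
    (Y : Ω → ℝ) (β K : ℝ) (hβ : 0 < β) (hK : 1 ≤ K)
    (hm : AEMeasurable (fun ω => (Y ω) ^ 2) P)
    (htail : ∀ A : ℝ, 0 < A →
        P {ω | A < |Y ω|} ≤ ENNReal.ofReal (Real.exp K * Real.exp (-(A ^ 2) / (2 * β ^ 2)))) :
    ∫⁻ ω, ENNReal.ofReal (Real.exp ((Y ω) ^ 2 / (4 * β ^ 2))) ∂P
      ≤ ENNReal.ofReal (2 * Real.exp K) := by
  have hW : AEMeasurable (fun ω => Real.exp ((Y ω) ^ 2 / (4 * β ^ 2))) P :=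
    Real.measurable_exp.comp_aemeasurable (hm.div_const _)
  rw [lintegral_eq_lintegral_meas_lt P (Filter.Eventually.of_forall fun ω => (Real.exp_pos _).le) hW]
  have hpt : ∀ t ∈ Set.Ioi (1 : ℝ), P {ω | t < Real.exp ((Y ω) ^ 2 / (4 * β ^ 2))}
      ≤ ENNReal.ofReal (Real.exp K * t ^ (-2 : ℝ)) := by
    intro t ht
    have ht1 : (1 : ℝ) < t := ht
    have ht0 : 0 < t := by linarith
    have hl : 0 < Real.log t := Real.log_pos ht1
    have hA : 0 < 2 * β * Real.sqrt (Real.log t) := by positivity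
    have hA2 : (2 * β * Real.sqrt (Real.log t)) ^ 2 = 4 * β ^ 2 * Real.log t := by
      rw [mul_pow, Real.sq_sqrt hl.le]; ring
    refine (measure_mono ?_).trans ((htail _ hA).trans_eq ?_)
    · intro ω hω
      simp only [Set.mem_ofPred_eq] at hω ⊢
      have h1 := (Real.log_lt_iff_lt_exp ht0).2 hω
      rw [lt_div_iff₀ (by positivity)] at h1
      rw [← abs_of_pos hA, ← sq_lt_sq, hA2]
      linarith
    · rw [hA2, Real.rpow_def_of_pos ht0]
      congr 3
      field_simp
      ring
  have hsplit : Set.Ioi (0 : ℝ) = Set.Ioc 0 1 ∪ Set.Ioi 1 :=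
    (Set.Ioc_union_Ioi_eq_Ioi zero_le_one).symm
  rw [hsplit]
  refine (lintegral_union_le _ _ _).trans ?_
  have h1 : ∫⁻ t in Set.Ioc (0 : ℝ) 1, P {ω | t < Real.exp ((Y ω) ^ 2 / (4 * β ^ 2))}
      ≤ ENNReal.ofReal 1 := by
    calc _ ≤ ∫⁻ t in Set.Ioc (0 : ℝ) 1, 1 := lintegral_mono fun t => prob_le_one
      _ = _ := by simp
  have h2 : ∫⁻ t in Set.Ioi (1 : ℝ), P {ω | t < Real.exp ((Y ω) ^ 2 / (4 * β ^ 2))}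
      ≤ ENNReal.ofReal (Real.exp K) := by
    refine (setLIntegral_mono' measurableSet_Ioi hpt).trans ?_
    rw [← ofReal_integral_eq_lintegral_ofReal]
    · apply ENNReal.ofReal_le_ofReal
      rw [integral_const_mul, integral_Ioi_rpow_of_lt (by norm_num) zero_lt_one]
      norm_num
    · exact (integrableOn_Ioi_rpow_of_lt (by norm_num) zero_lt_one).const_mul _
    · filter_upwards [ae_restrict_mem measurableSet_Ioi] with t ht
      have ht1 : (1 : ℝ) < t := ht
      have ht0 : 0 < t := by linarith
      positivity
  refine (add_le_add h1 h2).trans ?_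
  rw [← ENNReal.ofReal_add zero_le_one (Real.exp_pos _).le]
  apply ENNReal.ofReal_le_ofReal
  have := Real.one_le_exp (by linarith : (0 : ℝ) ≤ K)
  linarith

/-- The pointwise bound. -/
lemma exp_sq_pointwise (β K ν lam z A : ℝ) (hβ : 0 < β) (hν : 0 < ν) (hK : 1 ≤ K)
    (hL : 0 ≤ Real.log (β * K / ν))
    (hA : 4 * β ^ 2 * Real.log (β * K / ν) + 2 * β ^ 2 * K ≤ A ^ 2)
    (hlam : lam ^ 2 * A ^ 2 ≤ 1 / 16) (hz : 0 ≤ z) :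
    Real.exp (lam ^ 2 * z) ≤ 1 + lam ^ 2 * (3 * z + 16 * ν ^ 2 * Real.exp (-K) *
      Real.exp (z / (4 * β ^ 2)))  := by
  have hl2 : 0 ≤ lam ^ 2 := sq_nonneg _
  have h0 : Real.exp (lam ^ 2 * z) ≤ 1 + lam ^ 2 * (z * Real.exp (lam ^ 2 * z)) := by
    have h := Real.add_one_le_exp (-(lam ^ 2 * z))
    have h' := mul_le_mul_of_nonneg_right h (Real.exp_pos (lam ^ 2 * z)).le
    rw [← Real.exp_add, neg_add_cancel, Real.exp_zero] at h'
    linarith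
  refine h0.trans ?_
  gcongr
  rcases le_or_gt z (4 * A ^ 2) with h | h
  · have h3 : Real.exp (lam ^ 2 * z) ≤ 3 := by
      have : lam ^ 2 * z ≤ 1 := by nlinarith
      exact (Real.exp_le_exp.2 this).trans Real.exp_one_lt_three.le
    have : z * Real.exp (lam ^ 2 * z) ≤ z * 3 := by gcongr
    have : 0 ≤ 16 * ν ^ 2 * Real.exp (-K) * Real.exp (z / (4 * β ^ 2)) := by positivity
    linarith
  · have hbk : 0 < β * K / ν := by positivity
    have hlb : lam ^ 2 * z ≤ z / (16 * β ^ 2) := by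
      have hA1 : 2 * β ^ 2 ≤ A ^ 2 := by
        have := mul_nonneg (by positivity : 0 ≤ 4 * β ^ 2) hL
        nlinarith [mul_le_mul_of_nonneg_left hK (sq_nonneg β)]
      have hl3 : lam ^ 2 ≤ 1 / (16 * β ^ 2) := by
        rw [le_div_iff₀ (by positivity)]
        nlinarith
      calc lam ^ 2 * z ≤ 1 / (16 * β ^ 2) * z := by gcongr
        _ = _ := by ring
    have hz1 : z ≤ 16 * β ^ 2 * Real.exp (z / (16 * β ^ 2)) := by
      have := Real.add_one_le_exp (z / (16 * β ^ 2))
      have h1 : z / (16 * β ^ 2) ≤ Real.exp (z / (16 * β ^ 2)) := by linarith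
      rw [div_le_iff₀ (by positivity)] at h1
      linarith
    have hexp : Real.exp (z / (16 * β ^ 2)) * Real.exp (z / (16 * β ^ 2)) ≤
        (ν / (β * K)) ^ 2 * Real.exp (-K) * Real.exp (z / (4 * β ^ 2)) := by
      have : (ν / (β * K)) ^ 2 = Real.exp (-2 * Real.log (β * K / ν)) := by
        rw [mul_comm (-2 : ℝ), ← Real.rpow_def_of_pos hbk, Real.rpow_neg hbk.le, Real.rpow_ofNat]
        field_simp
      rw [this, ← Real.exp_add, ← Real.exp_add, ← Real.exp_add, Real.exp_le_exp]
      have h5 : 2 * Real.log (β * K / ν) + K ≤ z / (8 * β ^ 2) := by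
        rw [le_div_iff₀ (by positivity)]
        nlinarith
      have h6 : z / (16 * β ^ 2) = z / (8 * β ^ 2) / 2 := by field_simp; ring
      have h7 : z / (4 * β ^ 2) = z / (8 * β ^ 2) * 2 := by field_simp; ring
      rw [h6, h7]
      linarith
    calc z * Real.exp (lam ^ 2 * z)
        ≤ (16 * β ^ 2 * Real.exp (z / (16 * β ^ 2))) * Real.exp (z / (16 * β ^ 2)) := by gcongr
      _ = 16 * β ^ 2 * (Real.exp (z / (16 * β ^ 2)) * Real.exp (z / (16 * β ^ 2))) := by ring
      _ ≤ 16 * β ^ 2 * ((ν / (β * K)) ^ 2 * Real.exp (-K) * Real.exp (z / (4 * β ^ 2))) := by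
          gcongr
      _ = 16 * ν ^ 2 * Real.exp (-K) * Real.exp (z / (4 * β ^ 2)) * (1 / K ^ 2) := by
          field_simp
      _ ≤ 16 * ν ^ 2 * Real.exp (-K) * Real.exp (z / (4 * β ^ 2)) * 1 := by
          gcongr
          rw [div_le_one (by positivity)]
          nlinarith
      _ ≤ _ := by linarith

/-- **MGF bound for the square of a subGaussian random variable** (Theorem B.3 of
the paper). If `Y` is `(β², K)`-subGaussian with `K ≥ 1`, mean zero and variance
at most `ν² ≤ (βK)²`, then for `A := β√(4 log(βK/ν)) + β√(2K)` and any
`0 < λ ≤ c₀/A`, one has `E[exp(λ²Y²)] ≤ 1 + Cλ²ν²`. -/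
theorem subgaussian_square_mgf_bound :
    ∃ c₀ C : ℝ, 0 < c₀ ∧ 0 < C ∧
      ∀ (Ω : Type) (_ : MeasurableSpace Ω) (P : Measure Ω), IsProbabilityMeasure P →
      ∀ (Y : Ω → ℝ) (β K ν : ℝ), 0 < β → 1 ≤ K → 0 < ν → ν ≤ β * K →
      (∀ A : ℝ, 0 < A →
        P {ω | A < |Y ω|} ≤ ENNReal.ofReal (Real.exp K * Real.exp (-(A ^ 2) / (2 * β ^ 2)))) →
      (∫ ω, Y ω ∂P) = 0 →
      (∫ ω, (Y ω) ^ 2 ∂P) ≤ ν ^ 2 →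
      ∀ lam : ℝ, 0 < lam →
        lam ≤ c₀ / (β * Real.sqrt (4 * Real.log (β * K / ν)) + β * Real.sqrt (2 * K)) →
        ∫ ω, Real.exp (lam ^ 2 * (Y ω) ^ 2) ∂P ≤ 1 + C * lam ^ 2 * ν ^ 2 := by
  refine ⟨1 / 4, 35, by norm_num, by norm_num, ?_⟩
  intro Ω mΩ P hP Y β K ν hβ hK hν hνK htail _ hvar lam hlam hle
  by_cases hint : Integrable (fun ω => Real.exp (lam ^ 2 * (Y ω) ^ 2)) P
  swap
  · rw [integral_undef hint]
    positivity
  have hK0 : 0 < K := by linarith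
  have hL : 0 ≤ Real.log (β * K / ν) := Real.log_nonneg ((one_le_div hν).2 hνK)
  set A := β * Real.sqrt (4 * Real.log (β * K / ν)) + β * Real.sqrt (2 * K) with hAdef
  have hA0 : 0 < A := by positivity
  have hA : 4 * β ^ 2 * Real.log (β * K / ν) + 2 * β ^ 2 * K ≤ A ^ 2 := by
    have h1 := Real.sq_sqrt (by positivity : 0 ≤ 4 * Real.log (β * K / ν))
    have h2 := Real.sq_sqrt (by positivity : 0 ≤ 2 * K)
    have h3 : 0 ≤ 2 * β ^ 2 * (Real.sqrt (4 * Real.log (β * K / ν)) * Real.sqrt (2 * K)) := by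
      positivity
    have h4 : A ^ 2 = β ^ 2 * Real.sqrt (4 * Real.log (β * K / ν)) ^ 2
        + β ^ 2 * Real.sqrt (2 * K) ^ 2
        + 2 * β ^ 2 * (Real.sqrt (4 * Real.log (β * K / ν)) * Real.sqrt (2 * K)) := by
      rw [hAdef]; ring
    rw [h4, h1, h2]
    linarith
  have hlA : lam ^ 2 * A ^ 2 ≤ 1 / 16 := by
    rw [le_div_iff₀ hA0] at hle
    have : 0 ≤ lam * A := by positivity
    nlinarith
  have hm : AEMeasurable (fun ω => (Y ω) ^ 2) P := by
    have h1 := (Real.measurable_log.comp_aemeasurable hint.aemeasurable).div_const (lam ^ 2)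
    refine h1.congr (Filter.Eventually.of_forall fun ω => ?_)
    simp only [Function.comp, Real.log_exp]
    field_simp
  have hlin := lintegral_exp_sq_le P Y β K hβ hK hm htail
  have hWm : AEMeasurable (fun ω => Real.exp ((Y ω) ^ 2 / (4 * β ^ 2))) P :=
    Real.measurable_exp.comp_aemeasurable (hm.div_const _)
  have hWi : Integrable (fun ω => Real.exp ((Y ω) ^ 2 / (4 * β ^ 2))) P := by
    refine ⟨hWm.aestronglyMeasurable, ?_⟩
    rw [hasFiniteIntegral_iff_ofReal (Filter.Eventually.of_forall fun ω => (Real.exp_pos _).le)]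
    exact hlin.trans_lt ENNReal.ofReal_lt_top
  have hWb : ∫ ω, Real.exp ((Y ω) ^ 2 / (4 * β ^ 2)) ∂P ≤ 2 * Real.exp K := by
    rw [integral_eq_lintegral_of_nonneg_ae
      (Filter.Eventually.of_forall fun ω => (Real.exp_pos _).le) hWm.aestronglyMeasurable]
    exact ENNReal.toReal_le_of_le_ofReal (by positivity) hlin
  have hYi : Integrable (fun ω => (Y ω) ^ 2) P := by
    refine (hWi.const_mul (4 * β ^ 2)).mono' hm.aestronglyMeasurable
      (Filter.Eventually.of_forall fun ω => ?_)
    rw [Real.norm_of_nonneg (sq_nonneg _)]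
    have := Real.add_one_le_exp ((Y ω) ^ 2 / (4 * β ^ 2))
    have h1 : (Y ω) ^ 2 / (4 * β ^ 2) ≤ Real.exp ((Y ω) ^ 2 / (4 * β ^ 2)) := by linarith
    rw [div_le_iff₀ (by positivity)] at h1
    linarith
  have hi1 := hYi.const_mul 3
  have hi2 := hWi.const_mul (16 * ν ^ 2 * Real.exp (-K))
  have hi3 : Integrable (fun ω => lam ^ 2 * (3 * (Y ω) ^ 2 + 16 * ν ^ 2 * Real.exp (-K) *
      Real.exp ((Y ω) ^ 2 / (4 * β ^ 2)))) P := (hi1.add hi2).const_mul (lam ^ 2)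
  calc ∫ ω, Real.exp (lam ^ 2 * (Y ω) ^ 2) ∂P
      ≤ ∫ ω, (1 + lam ^ 2 * (3 * (Y ω) ^ 2 + 16 * ν ^ 2 * Real.exp (-K) *
          Real.exp ((Y ω) ^ 2 / (4 * β ^ 2)))) ∂P :=
        integral_mono hint ((integrable_const _).add hi3) fun ω =>
          exp_sq_pointwise β K ν lam _ A hβ hν hK hL hA hlA (sq_nonneg _)
    _ = 1 + lam ^ 2 * (3 * ∫ ω, (Y ω) ^ 2 ∂P + 16 * ν ^ 2 * Real.exp (-K) *
          ∫ ω, Real.exp ((Y ω) ^ 2 / (4 * β ^ 2)) ∂P) := by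
        rw [integral_add (integrable_const _) hi3, integral_const_mul, integral_add hi1 hi2,
          integral_const_mul, integral_const_mul]
        simp
    _ ≤ 1 + lam ^ 2 * (3 * ν ^ 2 + 16 * ν ^ 2 * Real.exp (-K) * (2 * Real.exp K)) := by
        gcongr
    _ = 1 + 35 * lam ^ 2 * ν ^ 2 := by
        have : Real.exp (-K) * Real.exp K = 1 := by rw [← Real.exp_add]; simp
        linear_combination lam ^ 2 * 32 * ν ^ 2 * this
end

section
/- Let h : ℝ^d → ℝ^{d×d} be measurable with ‖h(x)‖_op ≤ L for all x ∈ ℝ^d. For ε > 0 define the mollification h_ε(x) := E_z[h(x + εz)], where z is uniformly distributed on the closed unit Euclidean ball of ℝ^d (equivalently, h_ε(x) is the average of h over the ball B(x, ε) with respect to normalized Lebesgue measure). Then for all x, y ∈ ℝ^d: ‖h_ε(x) − h_ε(y)‖_op ≤ (2Ld/ε)·‖x − y‖. -/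
open MeasureTheory

lemma moll_aux {d : ℕ} (hd : 0 < d) (ε : ℝ) (hε : 0 < ε) (x y : EuclideanSpace ℝ (Fin d)) :
    ∃ C : Set (EuclideanSpace ℝ (Fin d)), MeasurableSet C ∧ C ⊆ Metric.closedBall x ε ∧
      C ⊆ Metric.closedBall y ε ∧
      (1 - d * (‖x - y‖ / ε)) * volume.real (Metric.closedBall x ε) ≤ volume.real C := by
  have hd1 : (1 : ℝ) ≤ d := by exact_mod_cast hd
  by_cases ht : ‖x - y‖ ≤ ε
  · refine ⟨Metric.closedBall x (ε - ‖x - y‖), Metric.isClosed_closedBall.measurableSet,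
      Metric.closedBall_subset_closedBall (by linarith [norm_nonneg (x - y)]),
      Metric.closedBall_subset_closedBall' (by rw [dist_eq_norm]; linarith), ?_⟩
    simp only [Measure.real]
    rw [Measure.addHaar_closedBall _ _ hε.le, Measure.addHaar_closedBall _ _ (sub_nonneg.2 ht),
      ENNReal.toReal_mul, ENNReal.toReal_mul, ENNReal.toReal_ofReal (by positivity),
      ENNReal.toReal_ofReal (pow_nonneg (sub_nonneg.2 ht) _), ← mul_assoc]
    refine mul_le_mul_of_nonneg_right ?_ ENNReal.toReal_nonneg
    rw [finrank_euclideanSpace_fin]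
    have h1 : ‖x - y‖ / ε ≤ 1 := (div_le_one hε).2 ht
    have hb := one_add_mul_le_pow (a := -(‖x - y‖ / ε)) (by linarith) d
    have he : ε - ‖x - y‖ = (1 + -(‖x - y‖ / ε)) * ε := by field_simp; ring
    rw [he, mul_pow]
    refine mul_le_mul_of_nonneg_right ?_ (by positivity)
    linarith
  · refine ⟨∅, MeasurableSet.empty, Set.empty_subset _, Set.empty_subset _, ?_⟩
    have h1 : 1 < ‖x - y‖ / ε := (one_lt_div hε).2 (not_le.1 ht)
    simp only [measureReal_empty]
    exact mul_nonpos_of_nonpos_of_nonneg (by nlinarith) measureReal_nonneg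

lemma moll_diff {d : ℕ} (L : ℝ)
    (h : EuclideanSpace ℝ (Fin d) →
      (EuclideanSpace ℝ (Fin d) →L[ℝ] EuclideanSpace ℝ (Fin d)))
    (hmeas : StronglyMeasurable h) (hbound : ∀ x, ‖h x‖ ≤ L)
    (B C : Set (EuclideanSpace ℝ (Fin d))) (hC : MeasurableSet C)
    (hBf : volume B < ⊤) (hCB : C ⊆ B) :
    ‖(∫ w in B, h w) - ∫ w in C, h w‖ ≤ L * (volume.real B - volume.real C) := by
  have hi : IntegrableOn h B :=
    Measure.integrableOn_of_bounded hBf.ne hmeas.aestronglyMeasurable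
      (Filter.Eventually.of_forall hbound)
  rw [← setIntegral_sdiff hC hi hCB, ← measureReal_sdiff hCB hC hBf.ne]
  exact norm_setIntegral_le_of_norm_le_const
    ((measure_mono Set.sdiff_subset).trans_lt hBf) (fun w _ => hbound w)

/-- **Mollification makes bounded matrix-valued maps Lipschitz** (Lemma C.8 of the
paper). If `h : ℝ^d → ℝ^{d×d}` (viewed as continuous linear maps on `ℝ^d`, so that
`‖h x‖` is the operator norm) is measurable and uniformly bounded in operator norm
by `L`, then its mollification `h_ε(x) := E_z[h(x + εz)]`, i.e. the average of `h`
over the ball `B(x, ε)` with respect to normalized Lebesgue measure, is Lipschitz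
with constant `2Ld/ε`. -/
theorem mollified_hessian_lipschitz
    {d : ℕ} (hd : 0 < d) (L ε : ℝ) (hL : 0 ≤ L) (hε : 0 < ε)
    (h : EuclideanSpace ℝ (Fin d) →
      (EuclideanSpace ℝ (Fin d) →L[ℝ] EuclideanSpace ℝ (Fin d)))
    (hmeas : StronglyMeasurable h)
    (hbound : ∀ x, ‖h x‖ ≤ L)
    (hmol : EuclideanSpace ℝ (Fin d) →
      (EuclideanSpace ℝ (Fin d) →L[ℝ] EuclideanSpace ℝ (Fin d)))
    (hmol_def : ∀ x, hmol x =
      ((volume (Metric.closedBall x ε)).toReal)⁻¹ • ∫ w in Metric.closedBall x ε, h w) :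
    ∀ x y, ‖hmol x - hmol y‖ ≤ (2 * L * (d : ℝ) / ε) * ‖x - y‖ := by
  intro x y
  obtain ⟨C, hC, hCx, hCy, hv⟩ := moll_aux hd ε hε x y
  have hx := moll_diff L h hmeas hbound _ C hC measure_closedBall_lt_top hCx
  have hy := moll_diff L h hmeas hbound _ C hC measure_closedBall_lt_top hCy
  have hVy : volume.real (Metric.closedBall y ε) = volume.real (Metric.closedBall x ε) := by
    simp only [Measure.real]
    rw [Measure.addHaar_closedBall _ _ hε.le, Measure.addHaar_closedBall _ _ hε.le]
  have hV : 0 < volume.real (Metric.closedBall x ε) :=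
    ENNReal.toReal_pos (Metric.measure_closedBall_pos _ _ hε).ne' measure_closedBall_lt_top.ne
  rw [hmol_def, hmol_def]
  change ‖(volume.real (Metric.closedBall x ε))⁻¹ • _ -
    (volume.real (Metric.closedBall y ε))⁻¹ • _‖ ≤ _
  rw [hVy] at hy ⊢
  set V := volume.real (Metric.closedBall x ε)
  have key : ∀ a b : EuclideanSpace ℝ (Fin d) →L[ℝ] EuclideanSpace ℝ (Fin d),
      ‖V⁻¹ • a - V⁻¹ • b‖ = ‖V⁻¹‖ * ‖a - b‖ := fun a b => by
    have e : V⁻¹ • a - V⁻¹ • b = V⁻¹ • (a - b) := by ext v; simp [mul_sub]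
    rw [e]; exact norm_smul _ _
  rw [key, Real.norm_of_nonneg (inv_nonneg.2 hV.le), inv_mul_le_iff₀ hV]
  have h3 := norm_sub_le_norm_sub_add_norm_sub (∫ w in Metric.closedBall x ε, h w)
    (∫ w in C, h w) (∫ w in Metric.closedBall y ε, h w)
  rw [norm_sub_rev (∫ w in C, h w)] at h3
  have h4 : L * (V - volume.real C) ≤ L * (d * (‖x - y‖ / ε) * V) :=
    mul_le_mul_of_nonneg_left (by linarith) hL
  calc _ ≤ 2 * (L * (d * (‖x - y‖ / ε) * V)) := by linarith
    _ = _ := by ring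
end
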